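/- Let (X_n)_{n∈ℕ} be a sequence of nonempty types and β ∈ (0,1]. For each t ∈ ℕ let (T_n^t)_{n∈ℕ} and (T_n)_{n∈ℕ} be maps 𝒰_{n+1} → 𝒰_n, all of them (1−β)-Lipschitz for d, and let (F_n^t) and (F_n) be sequences in 𝒰_n with F_n^t = T_n^t F_{n+1}^t and F_n = T_n F_{n+1} for all n. If sup_{n∈ℕ} d(T_n^t F_{n+1}, T_n F_{n+1}) → 0 as t → ∞, then sup_{n∈ℕ} d(F_n^t, F_n) → 0 as t → ∞; in particular F_n^t(x) → F_n(x) for every n and x ∈ X_n. -/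

import Mathlib

/-- The class `𝒰` of functions `X → ℝ` with values in `[0,1]`. -/
abbrev UnitBall (X : Type*) := {u : X → ℝ // ∀ x, u x ∈ Set.Icc (0 : ℝ) 1}

/-- The sup distance `d(f,g) = ⨆ x, |f x - g x|`. -/
noncomputable def supDist {X : Type*} (f g : X → ℝ) : ℝ := ⨆ x, |f x - g x|

theorem aux_bdd {X : Type*} (f g : UnitBall X) :
    BddAbove (Set.range fun x => |f.1 x - g.1 x|) := by
  refine ⟨1, ?_⟩
  rintro _ ⟨x, rfl⟩
  have h1 := f.2 x
  have h2 := g.2 x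
  exact abs_le.2 ⟨by linarith [h1.1, h2.2], by linarith [h1.2, h2.1]⟩

theorem aux_le {X : Type*} (f g : UnitBall X) (x : X) :
    |f.1 x - g.1 x| ≤ supDist f.1 g.1 := le_ciSup (aux_bdd f g) x

theorem aux_le_one {X : Type*} [Nonempty X] (f g : UnitBall X) : supDist f.1 g.1 ≤ 1 := by
  refine ciSup_le fun x => ?_
  have h1 := f.2 x
  have h2 := g.2 x
  exact abs_le.2 ⟨by linarith [h1.1, h2.2], by linarith [h1.2, h2.1]⟩

theorem aux_nonneg {X : Type*} (f g : UnitBall X) : 0 ≤ supDist f.1 g.1 :=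
  Real.iSup_nonneg fun _ => abs_nonneg _

theorem aux_tri {X : Type*} [Nonempty X] (f g h : UnitBall X) :
    supDist f.1 h.1 ≤ supDist f.1 g.1 + supDist g.1 h.1 :=
  ciSup_le fun x => (abs_sub_le _ (g.1 x) _).trans (add_le_add (aux_le f g x) (aux_le g h x))

theorem aux_bdd' {X : ℕ → Type*} [∀ n, Nonempty (X n)] (f g : ∀ n, UnitBall (X n)) :
    BddAbove (Set.range fun n => supDist (f n).1 (g n).1) := by
  refine ⟨1, ?_⟩
  rintro _ ⟨n, rfl⟩
  exact aux_le_one _ _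

/-- Stability of fixed sequences of `(1-β)`-Lipschitz operators: if the operators `T^t`
converge to `T` uniformly along the fixed sequence `F` of `T`, then the fixed sequences `F^t`
of `T^t` converge to `F` uniformly (hence pointwise). -/
theorem stmt10 (X : ℕ → Type*) [∀ n, Nonempty (X n)]
    (β : ℝ) (hβ0 : 0 < β) (hβ1 : β ≤ 1)
    (Tt : ℕ → ∀ n, UnitBall (X (n + 1)) → UnitBall (X n))
    (T : ∀ n, UnitBall (X (n + 1)) → UnitBall (X n))
    (hTt : ∀ t n (f g : UnitBall (X (n + 1))),
      supDist (Tt t n f).1 (Tt t n g).1 ≤ (1 - β) * supDist f.1 g.1)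
    (hT : ∀ n (f g : UnitBall (X (n + 1))),
      supDist (T n f).1 (T n g).1 ≤ (1 - β) * supDist f.1 g.1)
    (Ft : ℕ → ∀ n, UnitBall (X n)) (F : ∀ n, UnitBall (X n))
    (hFt : ∀ t n, Ft t n = Tt t n (Ft t (n + 1)))
    (hF : ∀ n, F n = T n (F (n + 1)))
    (hconv : Filter.Tendsto
      (fun t => ⨆ n, supDist (Tt t n (F (n + 1))).1 (T n (F (n + 1))).1)
      Filter.atTop (nhds 0)) :
    Filter.Tendsto (fun t => ⨆ n, supDist (Ft t n).1 (F n).1) Filter.atTop (nhds 0) ∧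
    ∀ n (x : X n),
      Filter.Tendsto (fun t => (Ft t n).1 x) Filter.atTop (nhds ((F n).1 x)) := by
  have key : ∀ t, (⨆ n, supDist (Ft t n).1 (F n).1) ≤
      (⨆ n, supDist (Tt t n (F (n + 1))).1 (T n (F (n + 1))).1) / β := by
    intro t
    rw [le_div_iff₀ hβ0]
    have hS : (⨆ n, supDist (Ft t n).1 (F n).1) ≤
        (1 - β) * (⨆ n, supDist (Ft t n).1 (F n).1) +
        ⨆ n, supDist (Tt t n (F (n + 1))).1 (T n (F (n + 1))).1 := by
      refine ciSup_le fun n => ?_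
      have h1 := aux_tri (Ft t n) (Tt t n (F (n + 1))) (F n)
      have h2 := hTt t n (Ft t (n + 1)) (F (n + 1))
      rw [← hFt t n] at h2
      have h3 : supDist (Ft t (n + 1)).1 (F (n + 1)).1 ≤ ⨆ n, supDist (Ft t n).1 (F n).1 :=
        le_ciSup (aux_bdd' (Ft t) F) (n + 1)
      have h4 : supDist (Tt t n (F (n + 1))).1 (T n (F (n + 1))).1 ≤
          ⨆ n, supDist (Tt t n (F (n + 1))).1 (T n (F (n + 1))).1 :=
        le_ciSup (aux_bdd' (fun n => Tt t n (F (n + 1))) (fun n => T n (F (n + 1)))) n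
      rw [← hF n] at h4
      have h5 := mul_le_mul_of_nonneg_left h3 (sub_nonneg.2 hβ1)
      linarith
    linarith
  have hlim : Filter.Tendsto (fun t => ⨆ n, supDist (Ft t n).1 (F n).1)
      Filter.atTop (nhds 0) := by
    refine squeeze_zero (fun t => Real.iSup_nonneg fun n => aux_nonneg _ _) key ?_
    simpa using hconv.div_const β
  refine ⟨hlim, fun n x => ?_⟩
  rw [tendsto_iff_dist_tendsto_zero]
  refine squeeze_zero (fun _ => dist_nonneg) (fun t => ?_) hlim
  rw [Real.dist_eq]
  exact (aux_le (Ft t n) (F n) x).trans (le_ciSup (aux_bdd' (Ft t) F) n)
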